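/- Let ε > 0. There is a constant C = C(ε) such that the following holds. Let ℓ be a prime, n a positive integer with 5n ≤ ℓ, and S a subset of F_ℓ. Write Ŝ(t) = ∑_{x ∈ S} e^{2πi x t / ℓ} for t ∈ F_ℓ (where x, t are lifted to integers). Then ∑_{0 < |r| ≤ ℓ/(5n)} ∑_{1 ≤ |a| ≤ n} |Ŝ(a·r mod ℓ)|^2 ≤ C · ℓ^{1 + ε} |S|, where a and r range over nonzero integers in the indicated ranges. -/

import Mathlib

/-- The Fourier transform of the indicator function of `S ⊆ F_ℓ` at `t ∈ F_ℓ`: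
`Ŝ(t) = ∑_{x ∈ S} e^{2πi x t / ℓ}`, using integer representatives of `x` and `t`. -/
noncomputable def Shat (ℓ : ℕ) (S : Finset (ZMod ℓ)) (t : ZMod ℓ) : ℂ :=
  ∑ x ∈ S, Complex.exp (2 * (Real.pi : ℂ) * Complex.I * ((x.val : ℂ) * (t.val : ℂ)) / (ℓ : ℂ))

open Finset in
/-- The divisor bound: `d(n) ≪_ε n^ε`. -/
theorem exists_card_divisors_le_rpow {ε : ℝ} (hε : 0 < ε) :
    ∃ C : ℝ, 0 ≤ C ∧ ∀ n : ℕ, n ≠ 0 → (#n.divisors : ℝ) ≤ C * (n : ℝ) ^ ε := by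
  have hlog : 0 < ε * Real.log 2 := mul_pos hε (Real.log_pos one_lt_two)
  set K : ℝ := 1 + 1 / (ε * Real.log 2) with hK
  have hK1 : 1 ≤ K := by rw [hK]; linarith [one_div_pos.mpr hlog]
  set B : ℕ := ⌈(2 : ℝ) ^ ε⁻¹⌉₊
  have factor_le (p v : ℕ) (hp : p.Prime) :
      ((v + 1 : ℕ) : ℝ) ≤ (if p < B then K else 1) * ((p : ℝ) ^ v) ^ ε := by
    have hp2 : (2 : ℝ) ≤ p := mod_cast hp.two_le
    have hswap : ((p : ℝ) ^ v) ^ ε = ((p : ℝ) ^ ε) ^ v := (Real.rpow_pow_comm (by positivity) _ _).symm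
    split_ifs with h
    · have h2 : ((2 : ℝ) ^ v) ^ ε ≤ ((p : ℝ) ^ v) ^ ε := by gcongr
      have h3 : 1 + v * (ε * Real.log 2) ≤ ((2 : ℝ) ^ v) ^ ε := by
        rw [Real.rpow_def_of_pos (by positivity), Real.log_pow]
        have := Real.add_one_le_exp ((v : ℝ) * Real.log 2 * ε)
        linarith
      have h4 : ((v + 1 : ℕ) : ℝ) ≤ K * (1 + v * (ε * Real.log 2)) := by
        have : K * (1 + v * (ε * Real.log 2)) = K + v * (ε * Real.log 2) + v := by
          rw [hK]; field_simp; ring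
        rw [this]
        push_cast
        have : 0 ≤ v * (ε * Real.log 2) := by positivity
        linarith
      exact h4.trans (by gcongr; exact h3.trans h2)
    · have h2 : (2 : ℝ) ≤ (p : ℝ) ^ ε := by
        have hle : (2 : ℝ) ^ ε⁻¹ ≤ p := (Nat.le_ceil _).trans (mod_cast not_lt.mp h)
        calc (2 : ℝ) = ((2 : ℝ) ^ ε⁻¹) ^ ε := by
              rw [← Real.rpow_mul (by norm_num), inv_mul_cancel₀ hε.ne', Real.rpow_one]
          _ ≤ _ := by gcongr
      rw [one_mul, hswap]
      calc ((v + 1 : ℕ) : ℝ) ≤ (2 : ℝ) ^ v := mod_cast Nat.lt_two_pow_self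
        _ ≤ _ := by gcongr
  refine ⟨K ^ B, by positivity, fun n hn ↦ ?_⟩
  calc (#n.divisors : ℝ) = ∏ p ∈ n.primeFactors, ((n.factorization p + 1 : ℕ) : ℝ) := by
        rw [Nat.card_divisors hn, Nat.cast_prod]
    _ ≤ ∏ p ∈ n.primeFactors,
          ((if p < B then K else 1) * ((p : ℝ) ^ n.factorization p) ^ ε) :=
        prod_le_prod (fun _ _ ↦ by positivity)
          fun p hp ↦ factor_le p _ (Nat.prime_of_mem_primeFactors hp)
    _ = K ^ #{p ∈ n.primeFactors | p < B} * (n : ℝ) ^ ε := by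
        rw [prod_mul_distrib, prod_ite, prod_const, prod_const_one, mul_one,
          Real.finsetProd_rpow _ _ (fun _ _ ↦ by positivity)]
        congr 2
        exact_mod_cast Nat.prod_factorization_pow_eq_self hn
    _ ≤ _ := by
        gcongr
        calc #{p ∈ n.primeFactors | p < B} ≤ #(range B) :=
              card_le_card fun p hp ↦ by simpa using (mem_filter.mp hp).2
          _ = B := card_range B

open Finset in
theorem Int.card_divisorsAntidiag (z : ℤ) : #z.divisorsAntidiag = 2 * #z.natAbs.divisors := by
  have key (n : ℕ) : #n.divisorsAntidiagonal = #n.divisors := by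
    rw [← Nat.map_div_right_divisors, card_map]
  rcases z with n | n
  · simp only [Int.divisorsAntidiag, card_disjUnion, card_map, key, two_mul, Int.ofNat_eq_natCast,
      Int.natAbs_natCast]
  · simp only [Int.divisorsAntidiag, card_disjUnion, card_map, key, two_mul, Int.natAbs_negSucc]

theorem Shat_eq_sum_stdAddChar {ℓ : ℕ} [NeZero ℓ] (S : Finset (ZMod ℓ)) (t : ZMod ℓ) :
    Shat ℓ S t = ∑ x ∈ S, ZMod.stdAddChar (t * x) := by
  refine Finset.sum_congr rfl fun x _ ↦ ?_
  have h : t * x = (((x.val * t.val : ℕ) : ℤ) : ZMod ℓ) := by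
    push_cast
    rw [ZMod.natCast_zmod_val, ZMod.natCast_zmod_val, mul_comm]
  rw [h, ZMod.stdAddChar_coe]
  push_cast
  rfl

/-- **Parseval's identity** on `ZMod ℓ` for indicator functions. -/
theorem sum_norm_sq_Shat {ℓ : ℕ} [NeZero ℓ] (S : Finset (ZMod ℓ)) :
    ∑ t, ‖Shat ℓ S t‖ ^ 2 = ℓ * S.card := by
  have h (t : ZMod ℓ) : ((‖Shat ℓ S t‖ ^ 2 : ℝ) : ℂ) =
      ∑ x ∈ S, ∑ y ∈ S, ZMod.stdAddChar (t * (y - x)) := by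
    rw [Complex.ofReal_pow, ← Complex.conj_mul', Shat_eq_sum_stdAddChar, map_sum,
      Finset.sum_mul_sum]
    refine Finset.sum_congr rfl fun x _ ↦ Finset.sum_congr rfl fun y _ ↦ ?_
    rw [← AddChar.map_neg_eq_conj, ← AddChar.map_add_eq_mul]
    congr 1
    ring
  have h' : ((∑ t, ‖Shat ℓ S t‖ ^ 2 : ℝ) : ℂ) = ((ℓ * S.card : ℝ) : ℂ) := by
    rw [Complex.ofReal_sum, Finset.sum_congr rfl fun t _ ↦ h t, Finset.sum_comm]
    simp_rw [Finset.sum_comm (s := Finset.univ)]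
    simp_rw [AddChar.sum_mulShift _ (ZMod.isPrimitive_stdAddChar ℓ), sub_eq_zero]
    simp [mul_comm]
  exact_mod_cast h'

open Finset in
/-- If all products `p.1 * p.2` over a finite set `P` of pairs of integers are nonzero and less
than `ℓ / 2` in absolute value, each residue mod `ℓ` is hit at most `2 d(m)` times for one of these
products `m`. -/
theorem card_filter_mul_cast_le {ℓ : ℕ} (P : Finset (ℤ × ℤ)) (D : ℝ) (hD : 0 ≤ D)
    (hP : ∀ p ∈ P, p.1 * p.2 ≠ 0 ∧ 2 * |p.1 * p.2| < ℓ)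
    (hdiv : ∀ m : ℕ, m ≠ 0 → m ≤ ℓ → (#m.divisors : ℝ) ≤ D) (t : ZMod ℓ) :
    (#{p ∈ P | ((p.1 * p.2 : ℤ) : ZMod ℓ) = t} : ℝ) ≤ 2 * D := by
  rcases eq_empty_or_nonempty {p ∈ P | ((p.1 * p.2 : ℤ) : ZMod ℓ) = t} with h | ⟨q, hq⟩
  · rw [h]; simpa using hD
  obtain ⟨hqP, hqt⟩ := mem_filter.mp hq
  obtain ⟨hq0, hqℓ⟩ := hP q hqP
  have hsub : {p ∈ P | ((p.1 * p.2 : ℤ) : ZMod ℓ) = t} ⊆ (q.1 * q.2).divisorsAntidiag := by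
    intro p hp
    obtain ⟨hpP, hpt⟩ := mem_filter.mp hp
    obtain ⟨-, hpℓ⟩ := hP p hpP
    refine (Int.prodMk_mem_divisorsAntidiag hq0).mpr (sub_eq_zero.mp ?_)
    refine Int.eq_zero_of_abs_lt_dvd
      ((ZMod.intCast_eq_intCast_iff_dvd_sub _ _ _).mp (hqt.trans hpt.symm)) ?_
    have := abs_sub (p.1 * p.2) (q.1 * q.2)
    lia
  calc (#{p ∈ P | ((p.1 * p.2 : ℤ) : ZMod ℓ) = t} : ℝ)
      ≤ ((2 * #(q.1 * q.2).natAbs.divisors : ℕ) : ℝ) := by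
        rw [← Int.card_divisorsAntidiag]
        exact_mod_cast card_le_card hsub
    _ ≤ 2 * D := by
        push_cast
        gcongr
        exact hdiv _ (Int.natAbs_ne_zero.mpr hq0) (by rw [Int.abs_eq_natAbs] at hqℓ; lia)

/-- Parseval-type bound: for a prime `ℓ`, `5n ≤ ℓ` and `S ⊆ F_ℓ`,
`∑_{0 < |r| ≤ ℓ/(5n)} ∑_{1 ≤ |a| ≤ n} |Ŝ(ar)|² ≤ C(ε) ℓ^{1+ε} |S|`. -/
theorem stmt_10 (ε : ℝ) (hε : 0 < ε) :
    ∃ C : ℝ, ∀ (ℓ : ℕ), ℓ.Prime → ∀ (n : ℕ), 0 < n → 5 * n ≤ ℓ →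
      ∀ (S : Finset (ZMod ℓ)),
      ∑ r ∈ (Finset.Icc (-⌊(ℓ : ℝ) / (5 * n)⌋) ⌊(ℓ : ℝ) / (5 * n)⌋).erase 0,
        ∑ a ∈ (Finset.Icc (-(n : ℤ)) (n : ℤ)).erase 0,
          ‖Shat ℓ S ((a * r : ℤ) : ZMod ℓ)‖ ^ 2
        ≤ C * (ℓ : ℝ) ^ ((1 : ℝ) + ε) * (S.card : ℝ) := by
  obtain ⟨C, hC, hdiv⟩ := exists_card_divisors_le_rpow hε
  refine ⟨2 * C, fun ℓ hℓ n hn _ S ↦ ?_⟩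
  have : NeZero ℓ := ⟨hℓ.ne_zero⟩
  have hℓ0 : (0 : ℝ) < ℓ := mod_cast hℓ.pos
  have hn0 : (0 : ℝ) < n := mod_cast hn
  set R := ⌊(ℓ : ℝ) / (5 * n)⌋ with hR
  have hRn : 5 * (n * R) ≤ (ℓ : ℤ) := by
    have h := Int.floor_le ((ℓ : ℝ) / (5 * n))
    rw [← hR, le_div_iff₀ (by positivity)] at h
    have : (5 * (n * R) : ℝ) ≤ ℓ := by linarith
    exact_mod_cast this
  set P := (Finset.Icc (-(n : ℤ)) n).erase 0 ×ˢ (Finset.Icc (-R) R).erase 0 with hPdef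
  have hP : ∀ p ∈ P, p.1 * p.2 ≠ 0 ∧ 2 * |p.1 * p.2| < ℓ := by
    rintro ⟨a, r⟩ hp
    simp only [hPdef, Finset.mem_product, Finset.mem_erase, Finset.mem_Icc, ← abs_le] at hp
    obtain ⟨⟨ha0, ha⟩, hr0, hr⟩ := hp
    refine ⟨mul_ne_zero ha0 hr0, ?_⟩
    have hmul : |a * r| ≤ n * R := by
      rw [abs_mul]
      exact mul_le_mul ha hr (abs_nonneg r) (by positivity)
    have := hℓ.pos
    lia
  have hfib := card_filter_mul_cast_le P (C * (ℓ : ℝ) ^ ε) (by positivity) hP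
    fun m hm hmℓ ↦ (hdiv m hm).trans (by gcongr)
  rw [Finset.sum_comm, ← Finset.sum_product', ← Finset.sum_fiberwise' P
    (fun p ↦ ((p.1 * p.2 : ℤ) : ZMod ℓ)) (fun t ↦ ‖Shat ℓ S t‖ ^ 2)]
  calc ∑ t, ∑ p ∈ P with ((p.1 * p.2 : ℤ) : ZMod ℓ) = t, ‖Shat ℓ S t‖ ^ 2
      ≤ ∑ t, 2 * (C * (ℓ : ℝ) ^ ε) * ‖Shat ℓ S t‖ ^ 2 := by
        refine Finset.sum_le_sum fun t _ ↦ ?_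
        rw [Finset.sum_const, nsmul_eq_mul]
        gcongr
        exact hfib t
    _ = 2 * C * (ℓ : ℝ) ^ (1 + ε) * S.card := by
        rw [← Finset.mul_sum, sum_norm_sq_Shat, Real.rpow_add hℓ0, Real.rpow_one]
        ring
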